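/- For all integers 0 ≤ x ≤ n and 0 ≤ j ≤ n, Σ_{i=0}^{n} binom(n-i, n-j) · K_i(x;n) = 4^j · binom(n-x, j). -/

import Mathlib

open Finset

/-- Quaternary Krawtchouk polynomial at integer points. -/
noncomputable def kraw (n i x : ℕ) : ℝ :=
  ∑ l ∈ Finset.range (i + 1),
    (-1 : ℝ) ^ l * 3 ^ (i - l) * (x.choose l) * ((n - x).choose (i - l))

open Polynomial in
/-- The coefficients of a power of a linear polynomial. -/
theorem Polynomial.coeff_C_add_C_mul_X_pow {R : Type*} [CommRing R] (s b : R) (m k : ℕ) :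
    ((C s + C b * X) ^ m).coeff k = b ^ k * s ^ (m - k) * (m.choose k : R) := by
  rw [add_comm, add_pow, finsetSum_coeff]
  have h : ∀ i, ((C b * X) ^ i * C s ^ (m - i) * (m.choose i : R[X])).coeff k =
      if k = i then b ^ i * s ^ (m - i) * (m.choose i : R) else 0 := by
    intro i
    have : (C b * X) ^ i * C s ^ (m - i) * (m.choose i : R[X]) =
        C (b ^ i * s ^ (m - i) * (m.choose i : R)) * X ^ i := by
      simp only [mul_pow, C_mul, C_pow, C_eq_natCast]
      ring
    rw [this, coeff_C_mul_X_pow]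
  simp only [h, Finset.sum_ite_eq, Finset.mem_range]
  split_ifs with hk
  · rfl
  · rw [Nat.choose_eq_zero_of_lt (by omega)]
    simp

open Polynomial in
/-- The homogeneous generating function of the Krawtchouk polynomials. -/
theorem sum_kraw_smul_pow {A : Type*} [CommRing A] [Algebra ℝ A] (s : A) {n x : ℕ} (hx : x ≤ n) :
    ∑ i ∈ Finset.range (n + 1), kraw n i x • s ^ (n - i) = (s - 1) ^ x * (s + 3) ^ (n - x) := by
  set P : A[X] := (C s + C (-1) * X) ^ x * (C s + C 3 * X) ^ (n - x) with hP
  have hcoeff : ∀ i, P.coeff i = kraw n i x • s ^ (n - i) := by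
    intro i
    rw [hP, coeff_mul, Finset.Nat.sum_antidiagonal_eq_sum_range_succ_mk, kraw, Finset.sum_smul]
    refine Finset.sum_congr rfl fun l hl ↦ ?_
    rw [Finset.mem_range] at hl
    rw [coeff_C_add_C_mul_X_pow, coeff_C_add_C_mul_X_pow]
    simp only [Algebra.smul_def, map_mul, map_pow, map_neg, map_one, map_natCast, map_ofNat]
    by_cases hlx : x < l
    · simp [Nat.choose_eq_zero_of_lt hlx]
    by_cases hil : n - x < i - l
    · simp [Nat.choose_eq_zero_of_lt hil]
    rw [show n - i = (x - l) + (n - x - (i - l)) by omega, pow_add]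
    ring
  have hlin : ∀ b : A, (C s + C b * X).natDegree ≤ 1 := fun b ↦ by compute_degree
  have hdeg : P.natDegree < n + 1 := by
    have h := natDegree_mul_le_of_le (natDegree_pow_le_of_le x (hlin (-1)))
      (natDegree_pow_le_of_le (n - x) (hlin 3))
    rw [← hP] at h
    omega
  calc _ = P.eval 1 := by simp [eval_eq_sum_range' hdeg, hcoeff]
    _ = _ := by simp [hP, sub_eq_add_neg]

open Polynomial in
theorem kraw_binom_sum (n x j : ℕ) (hx : x ≤ n) (hj : j ≤ n) :
    ∑ i ∈ Finset.range (n + 1), ((n - i).choose (n - j) : ℝ) * kraw n i x =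
      (4 : ℝ) ^ j * ((n - x).choose j) := by
  have h := congrArg (fun p : ℝ[X] ↦ p.coeff (n - j)) (sum_kraw_smul_pow (X + 1 : ℝ[X]) hx)
  have h4 : (X + 1 + 3 : ℝ[X]) = X + C 4 := by
    rw [add_assoc]
    norm_num
    rfl
  simp only [finsetSum_coeff, coeff_smul, coeff_X_add_one_pow, smul_eq_mul,
    add_sub_cancel_right, h4, coeff_X_pow_mul', coeff_X_add_C_pow] at h
  simp only [mul_comm _ (kraw _ _ _), h]
  split_ifs with hxj
  · rw [show n - x - (n - j - x) = j by omega, Nat.choose_symm_of_eq_add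
      (show n - x = (n - j - x) + j by omega)]
  · rw [Nat.choose_eq_zero_of_lt (by omega)]
    simp
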